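/- arXiv:2112.03504 — 2 statements merged into one kernel-verified Lean document; each statement's English description precedes it below -/
import Mathlib

section
/- Let r, f : ℝ^d → ℝ be differentiable, with r μ-strongly convex and μ'-smooth and f λ-strongly convex, let 0 < η < μ'/λ, and assume that the function r − η·f is convex. If u, v, x, y ∈ ℝ^d satisfy ∇r(u) = ∇r(x) − η·∇f(x) and ∇r(v) = ∇r(y) − η·∇f(y), then ‖u − v‖ ≤ ((μ' − ηλ)/μ)·‖x − y‖. -/
open RealInnerProductSpace Finset

/-- `h'` is the gradient of `h` at every point. -/
def HasGradFn {d : ℕ} (h : EuclideanSpace ℝ (Fin d) → ℝ)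
    (h' : EuclideanSpace ℝ (Fin d) → EuclideanSpace ℝ (Fin d)) : Prop :=
  ∀ x, HasGradientAt h (h' x) x

/-- `h` is `c`-strongly convex with gradient `h'`. -/
def StrongConvexGrad {d : ℕ} (c : ℝ) (h : EuclideanSpace ℝ (Fin d) → ℝ)
    (h' : EuclideanSpace ℝ (Fin d) → EuclideanSpace ℝ (Fin d)) : Prop :=
  ∀ x y, h x + ⟪h' x, y - x⟫ + c / 2 * ‖y - x‖ ^ 2 ≤ h y

/-- `h` is `c`-smooth with gradient `h'`. -/
def SmoothGrad {d : ℕ} (c : ℝ) (h : EuclideanSpace ℝ (Fin d) → ℝ)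
    (h' : EuclideanSpace ℝ (Fin d) → EuclideanSpace ℝ (Fin d)) : Prop :=
  ∀ x y, h y ≤ h x + ⟪h' x, y - x⟫ + c / 2 * ‖y - x‖ ^ 2

/-- Bregman divergence `D_r(x, y)` of `r` with gradient `r'`. -/
noncomputable def bregman {d : ℕ} (r : EuclideanSpace ℝ (Fin d) → ℝ)
    (r' : EuclideanSpace ℝ (Fin d) → EuclideanSpace ℝ (Fin d))
    (x y : EuclideanSpace ℝ (Fin d)) : ℝ :=
  r x - r y - ⟪r' y, x - y⟫

section ConvexGradient

variable {E : Type*} [NormedAddCommGroup E] [InnerProductSpace ℝ E]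

/-- A convex function lies above its tangent hyperplanes. -/
theorem ConvexOn.add_inner_gradient_le [CompleteSpace E] {g : E → ℝ} {a x : E}
    (hg : ConvexOn ℝ Set.univ g) (ha : HasGradientAt g a x) (y : E) :
    g x + ⟪a, y - x⟫ ≤ g y := by
  have hline : ConvexOn ℝ Set.univ (g ∘ AffineMap.lineMap (k := ℝ) x y) := by
    simpa using hg.comp_affineMap (AffineMap.lineMap (k := ℝ) x y)
  have hfd : HasFDerivAt g (InnerProductSpace.toDual ℝ E a)
      (AffineMap.lineMap (k := ℝ) x y (0 : ℝ)) := by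
    simpa using ha.hasFDerivAt
  have hderiv : HasDerivAt (g ∘ AffineMap.lineMap (k := ℝ) x y) ⟪a, y - x⟫ 0 := by
    simpa using hfd.comp_hasDerivAt (0 : ℝ) AffineMap.hasDerivAt_lineMap
  have h := hline.le_slope_of_hasDerivAt (Set.mem_univ 0) (Set.mem_univ 1) one_pos hderiv
  simp [slope_def_field] at h
  linarith

/-- If `g` lies above its tangent hyperplanes and is `L`-smooth, then its excess over a tangent
hyperplane controls the variation of the gradient. -/
theorem norm_gradient_sub_sq_le {g : E → ℝ} {g' : E → E} {L : ℝ} (hL : 0 < L)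
    (hlow : ∀ x y, g x + ⟪g' x, y - x⟫ ≤ g y)
    (hup : ∀ x y, g y ≤ g x + ⟪g' x, y - x⟫ + L / 2 * ‖y - x‖ ^ 2) (x y : E) :
    g x + ⟪g' x, y - x⟫ + 1 / (2 * L) * ‖g' y - g' x‖ ^ 2 ≤ g y := by
  set w := g' y - g' x with hw
  have h₁ := hlow x (y - L⁻¹ • w)
  have h₂ := hup y (y - L⁻¹ • w)
  have hinner : ⟪g' y, w⟫ - ⟪g' x, w⟫ = ‖w‖ ^ 2 := by
    rw [← inner_sub_left, ← hw, real_inner_self_eq_norm_sq]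
  rw [show y - L⁻¹ • w - x = (y - x) - L⁻¹ • w by abel, inner_sub_right,
    real_inner_smul_right] at h₁
  rw [show y - L⁻¹ • w - y = -(L⁻¹ • w) by abel, inner_neg_right, real_inner_smul_right, norm_neg,
    norm_smul, mul_pow, Real.norm_eq_abs, sq_abs] at h₂
  have hcoef : L / 2 * (L⁻¹ ^ 2 * ‖w‖ ^ 2) = 1 / (2 * L) * ‖w‖ ^ 2 := by
    field_simp
  have hscaled : L⁻¹ * ⟪g' y, w⟫ - L⁻¹ * ⟪g' x, w⟫ = 2 * (1 / (2 * L) * ‖w‖ ^ 2) := by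
    rw [← mul_sub, hinner]
    field_simp
  linarith

/-- The gradient of an `L`-smooth function lying above its tangent hyperplanes is
`L`-Lipschitz. -/
theorem norm_gradient_sub_le {g : E → ℝ} {g' : E → E} {L : ℝ} (hL : 0 < L)
    (hlow : ∀ x y, g x + ⟪g' x, y - x⟫ ≤ g y)
    (hup : ∀ x y, g y ≤ g x + ⟪g' x, y - x⟫ + L / 2 * ‖y - x‖ ^ 2) (x y : E) :
    ‖g' x - g' y‖ ≤ L * ‖x - y‖ := by
  have h₁ := norm_gradient_sub_sq_le hL hlow hup x y
  have h₂ := norm_gradient_sub_sq_le hL hlow hup y x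
  rw [norm_sub_rev (g' y), ← neg_sub x y, inner_neg_right] at h₁
  have hcs := real_inner_le_norm (g' x - g' y) (x - y)
  rw [inner_sub_left] at hcs
  have hcoef : 2 * (1 / (2 * L) * ‖g' x - g' y‖ ^ 2) = ‖g' x - g' y‖ ^ 2 / L := by
    field_simp
  have h : ‖g' x - g' y‖ ^ 2 / L ≤ ‖g' x - g' y‖ * ‖x - y‖ := by linarith
  rw [div_le_iff₀ hL] at h
  rcases (norm_nonneg (g' x - g' y)).eq_or_lt with h0 | h0
  · rw [← h0]
    positivity
  · exact le_of_mul_le_mul_left (by linarith) h0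

end ConvexGradient

/-- The gradient of a `c`-strongly convex function expands distances by at least `c`. -/
theorem StrongConvexGrad.mul_norm_sub_le {d : ℕ} {c : ℝ} {h : EuclideanSpace ℝ (Fin d) → ℝ}
    {h' : EuclideanSpace ℝ (Fin d) → EuclideanSpace ℝ (Fin d)} (hh : StrongConvexGrad c h h')
    (u v : EuclideanSpace ℝ (Fin d)) : c * ‖u - v‖ ≤ ‖h' u - h' v‖ := by
  have h₁ := hh u v
  have h₂ := hh v u
  rw [norm_sub_rev, ← neg_sub u v, inner_neg_right] at h₁
  have hcs := real_inner_le_norm (h' u - h' v) (u - v)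
  rw [inner_sub_left] at hcs
  rcases (norm_nonneg (u - v)).eq_or_lt with h0 | h0
  · rw [← h0, mul_zero]
    positivity
  · exact le_of_mul_le_mul_right (by linarith) h0

/-- The contraction step (equations (16)–(17)) in the proof of Lemma 1:
the unconstrained mirror map `x ↦ (∇r)⁻¹(∇r(x) − η∇f(x))` is a `ρ`-contraction
with `ρ = (μ' − ηλ)/μ`. -/
theorem mirror_map_contraction
    {d : ℕ} (r f : EuclideanSpace ℝ (Fin d) → ℝ)
    (r' f' : EuclideanSpace ℝ (Fin d) → EuclideanSpace ℝ (Fin d))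
    (hrdiff : HasGradFn r r') (hfdiff : HasGradFn f f')
    (mu mu' lam eta : ℝ) (hmu : 0 < mu) (hlam : 0 < lam)
    (hrsc : StrongConvexGrad mu r r') (hrsm : SmoothGrad mu' r r')
    (hfsc : StrongConvexGrad lam f f')
    (heta0 : 0 < eta) (heta : eta < mu' / lam)
    (hconv : ConvexOn ℝ Set.univ (fun x => r x - eta * f x))
    (u v x y : EuclideanSpace ℝ (Fin d))
    (hu : r' u = r' x - eta • f' x) (hv : r' v = r' y - eta • f' y) :
    ‖u - v‖ ≤ (mu' - eta * lam) / mu * ‖x - y‖ := by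
  have hL : 0 < mu' - eta * lam := sub_pos.2 ((lt_div_iff₀ hlam).1 heta)
  have hgrad (z) : HasGradientAt (fun x => r x - eta * f x) (r' z - eta • f' z) z := by
    rw [hasGradientAt_iff_hasFDerivAt, map_sub, map_smul]
    exact (hrdiff z).hasFDerivAt.sub ((hfdiff z).hasFDerivAt.const_mul eta)
  have hsmooth (a b) : r b - eta * f b ≤ r a - eta * f a + ⟪r' a - eta • f' a, b - a⟫
      + (mu' - eta * lam) / 2 * ‖b - a‖ ^ 2 := by
    have h := mul_le_mul_of_nonneg_left (hfsc a b) heta0.le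
    rw [inner_sub_left, real_inner_smul_left]
    linarith [hrsm a b]
  have hlip := norm_gradient_sub_le (g' := fun z => r' z - eta • f' z) hL
    (fun a b => hconv.add_inner_gradient_le (hgrad a) b) hsmooth x y
  have hexp := hrsc.mul_norm_sub_le u v
  rw [hu, hv] at hexp
  rw [div_mul_eq_mul_div, le_div_iff₀ hmu]
  linarith
end

section
/- Let X ⊆ ℝ^d be convex, let r : ℝ^d → ℝ be differentiable and μ-strongly convex with μ > 0, let η > 0, let u ∈ ℝ^d, and let g₁, g₂ ∈ ℝ^d. Suppose x₁ ∈ X minimizes x ↦ ⟪g₁, x⟫ + (1/η)·D_r(x, u) over X and x₂ ∈ X minimizes x ↦ ⟪g₂, x⟫ + (1/η)·D_r(x, u) over X. Then ‖x₁ − x₂‖ ≤ (η/μ)·‖g₁ − g₂‖. -/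
open RealInnerProductSpace Finset

theorem StrongConvexGrad.mul_norm_sub_sq_le_inner {d : ℕ} {c : ℝ}
    {h : EuclideanSpace ℝ (Fin d) → ℝ} {h' : EuclideanSpace ℝ (Fin d) → EuclideanSpace ℝ (Fin d)}
    (hc : StrongConvexGrad c h h') (x y : EuclideanSpace ℝ (Fin d)) :
    c * ‖x - y‖ ^ 2 ≤ ⟪h' x - h' y, x - y⟫ := by
  have hxy := hc x y
  have hyx := hc y x
  rw [← neg_sub x y, inner_neg_right, norm_neg] at hxy
  rw [inner_sub_left]
  linarith

/-- The derivative of the mirror descent objective. -/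
theorem hasFDerivAt_inner_add_bregman {d : ℕ} {r : EuclideanSpace ℝ (Fin d) → ℝ}
    {r' : EuclideanSpace ℝ (Fin d) → EuclideanSpace ℝ (Fin d)} (hr : HasGradFn r r')
    (a : ℝ) (u g x : EuclideanSpace ℝ (Fin d)) :
    HasFDerivAt (fun z => ⟪g, z⟫ + a * bregman r r' z u)
      (innerSL ℝ g + a • (innerSL ℝ (r' x) - innerSL ℝ (r' u))) x := by
  have hlin : HasFDerivAt (fun z => ⟪r' u, z - u⟫) (innerSL ℝ (r' u)) x :=
    (innerSL ℝ (r' u)).hasFDerivAt.comp x ((hasFDerivAt_id x).sub_const u)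
  exact (innerSL ℝ g).hasFDerivAt.add
    ((((hr x).hasFDerivAt.sub_const (r u)).sub hlin).const_mul a)

/-- The first-order optimality condition for a mirror descent update. -/
theorem IsMinOn.inner_add_bregman_nonneg {d : ℕ} {X : Set (EuclideanSpace ℝ (Fin d))}
    (hX : Convex ℝ X) {r : EuclideanSpace ℝ (Fin d) → ℝ}
    {r' : EuclideanSpace ℝ (Fin d) → EuclideanSpace ℝ (Fin d)} (hr : HasGradFn r r')
    {a : ℝ} {u g x y : EuclideanSpace ℝ (Fin d)}
    (hmin : IsMinOn (fun z => ⟪g, z⟫ + a * bregman r r' z u) X x) (hx : x ∈ X) (hy : y ∈ X) :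
    0 ≤ ⟪g, y - x⟫ + a * (⟪r' x, y - x⟫ - ⟪r' u, y - x⟫) :=
  hmin.localize.hasFDerivWithinAt_nonneg
    (hasFDerivAt_inner_add_bregman hr a u g x).hasFDerivWithinAt
    (sub_mem_posTangentConeAt_of_segment_subset (hX.segment_subset hx hy))

/-- Nonexpansiveness of the mirror descent update in its gradient argument
(underlying the bound on the network error `δ_t`, equation (24)). -/
theorem mirror_descent_nonexpansive_in_gradient
    {d : ℕ} (X : Set (EuclideanSpace ℝ (Fin d))) (hXconv : Convex ℝ X)
    (r : EuclideanSpace ℝ (Fin d) → ℝ)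
    (r' : EuclideanSpace ℝ (Fin d) → EuclideanSpace ℝ (Fin d))
    (hrdiff : HasGradFn r r')
    (mu : ℝ) (hmu : 0 < mu) (hrsc : StrongConvexGrad mu r r')
    (eta : ℝ) (heta : 0 < eta)
    (u g₁ g₂ x₁ x₂ : EuclideanSpace ℝ (Fin d))
    (hx₁X : x₁ ∈ X) (hx₂X : x₂ ∈ X)
    (hx₁ : IsMinOn (fun z => ⟪g₁, z⟫ + (1 / eta) * bregman r r' z u) X x₁)
    (hx₂ : IsMinOn (fun z => ⟪g₂, z⟫ + (1 / eta) * bregman r r' z u) X x₂) :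
    ‖x₁ - x₂‖ ≤ eta / mu * ‖g₁ - g₂‖ := by
  have h₁ := hx₁.inner_add_bregman_nonneg hXconv hrdiff hx₁X hx₂X
  have h₂ := hx₂.inner_add_bregman_nonneg hXconv hrdiff hx₂X hx₁X
  have hmono := hrsc.mul_norm_sub_sq_le_inner x₁ x₂
  have hcs := real_inner_le_norm (g₂ - g₁) (x₁ - x₂)
  rw [inner_sub_left] at hmono hcs
  rw [norm_sub_rev g₂ g₁] at hcs
  rw [← neg_sub x₁ x₂] at h₁
  simp only [inner_neg_right] at h₁
  have hsum : 1 / eta * (⟪r' x₁, x₁ - x₂⟫ - ⟪r' x₂, x₁ - x₂⟫) ≤ ‖g₁ - g₂‖ * ‖x₁ - x₂‖ := by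
    linarith
  rw [one_div_mul_eq_div, div_le_iff₀ heta] at hsum
  rw [div_mul_eq_mul_div, le_div_iff₀ hmu]
  rcases (norm_nonneg (x₁ - x₂)).eq_or_lt with h0 | hpos
  · rw [← h0, zero_mul]
    positivity
  · refine le_of_mul_le_mul_right ?_ hpos
    linarith
end
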